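/- Let H_1, H_2 be hyperplanes of T, and let a, b ∈ V' with r·a ∉ H_1 and r·b ∉ H_2, such that C(H_1,a) and C(H_2,b) are distinct classes (i.e., C(H_1,a) ≠ C(H_2,b)). Then the vertices [a] and [b] have exactly q^{2e-3}·(q−1)·(q^{2e-2}−1) common neighbours in the graph Y(2e,K). -/

import Mathlib

open Matrix

/-- The symplectic form `a M bᵀ` where `M = [[0, Iₑ],[-Iₑ, 0]]`. -/
def sympForm (K : Type) [CommRing K] (e : ℕ) (a b : Fin e ⊕ Fin e → K) : K :=
  a ⬝ᵥ ((Matrix.fromBlocks (0 : Matrix (Fin e) (Fin e) K) 1 (-1) 0) *ᵥ b)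

/-- `V'`: the set of 2e-tuples over `K` having at least one unit entry. -/
def unitTuples (K : Type) [CommRing K] (e : ℕ) : Set (Fin e ⊕ Fin e → K) :=
  {a | ∃ i, IsUnit (a i)}

/-- The equivalence class `[a]` of a tuple under unit scaling. -/
def cls (K : Type) [CommRing K] (e : ℕ) (a : Fin e ⊕ Fin e → K) :
    Set (Fin e ⊕ Fin e → K) :=
  {b | ∃ σ : Kˣ, b = σ • a}

/-- `V`: the set of equivalence classes of elements of `V'` under unit scaling. -/
def classes (K : Type) [CommRing K] (e : ℕ) : Set (Set (Fin e ⊕ Fin e → K)) :=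
  {S | ∃ a ∈ unitTuples K e, S = cls K e a}

/-- Adjacency in the graph `X(2e,K)`: `a M bᵀ ∈ K \ {0}`. -/
def adjX (K : Type) [CommRing K] (e : ℕ) (A B : Set (Fin e ⊕ Fin e → K)) : Prop :=
  ∃ a ∈ A, ∃ b ∈ B, sympForm K e a b ≠ 0

/-- Adjacency in the complement of `X(2e,K)`: distinct classes with `a M bᵀ = 0`. -/
def adjXc (K : Type) [CommRing K] (e : ℕ) (A B : Set (Fin e ⊕ Fin e → K)) : Prop :=
  A ≠ B ∧ ∃ a ∈ A, ∃ b ∈ B, sympForm K e a b = 0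

/-- Adjacency in the graph `Y(2e,K)`: `a M bᵀ ∈ J \ {0}`. -/
def adjY (K : Type) [CommRing K] (J : Ideal K) (e : ℕ)
    (A B : Set (Fin e ⊕ Fin e → K)) : Prop :=
  ∃ a ∈ A, ∃ b ∈ B, sympForm K e a b ∈ J ∧ sympForm K e a b ≠ 0

/-- `T = J × ⋯ × J` (2e factors), as a subset of `K^{2e}`. -/
def Tset (K : Type) [CommRing K] (J : Ideal K) (e : ℕ) : Set (Fin e ⊕ Fin e → K) :=
  {x | ∀ i, x i ∈ J}

/-- A hyperplane of `T`: a `K`-submodule contained in `T` of cardinality `q^(2e-1)`. -/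
def IsHyperplane (K : Type) [CommRing K] (J : Ideal K) (e q : ℕ)
    (H : Submodule K (Fin e ⊕ Fin e → K)) : Prop :=
  (H : Set (Fin e ⊕ Fin e → K)) ⊆ Tset K J e ∧ Nat.card H = q ^ (2 * e - 1)

/-- `C(H,u) = {[u+h] : h ∈ H}`. -/
def classSet (K : Type) [CommRing K] (e : ℕ) (H : Submodule K (Fin e ⊕ Fin e → K))
    (u : Fin e ⊕ Fin e → K) : Set (Set (Fin e ⊕ Fin e → K)) :=
  {S | ∃ h ∈ (H : Set (Fin e ⊕ Fin e → K)), S = cls K e (u + h)}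

/-- The set of tuples `{σ • (u+h) : σ ∈ Kˣ, h ∈ H}`. -/
def orbitSet (K : Type) [CommRing K] (e : ℕ) (H : Submodule K (Fin e ⊕ Fin e → K))
    (u : Fin e ⊕ Fin e → K) : Set (Fin e ⊕ Fin e → K) :=
  {x | ∃ σ : Kˣ, ∃ h ∈ (H : Set (Fin e ⊕ Fin e → K)), x = σ • (u + h)}

/-- The coset `c • u + T` of `T`. -/
def cosetOf (K : Type) [CommRing K] (J : Ideal K) (e : ℕ) (c : K)
    (u : Fin e ⊕ Fin e → K) : Set (Fin e ⊕ Fin e → K) :=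
  {x | ∃ t ∈ Tset K J e, x = c • u + t}

section FibreCounting

variable {G H : Type*} [AddCommGroup G] [AddCommGroup H]

/-- If `f` maps the subgroup `A` onto the subgroup `B`, every subset of `B` has a preimage in `A`
made of cosets of `A ∩ ker f`. -/
theorem ncard_inter_preimage_eq (f : G →+ H) (A : AddSubgroup G) {S : Set H}
    (hS : S ⊆ f '' A) :
    ((A : Set G) ∩ f ⁻¹' S).ncard = S.ncard * ((A : Set G) ∩ f ⁻¹' {0}).ncard := by
  have hS : ∀ s : H, ∃ x : G, s ∈ S → x ∈ A ∧ f x = s := fun s => by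
    by_cases hs : s ∈ S
    · exact (hS hs).imp fun _ hx _ => hx
    · exact ⟨0, fun hs' => absurd hs' hs⟩
  choose g hgS using hS
  have hgA : ∀ {s}, s ∈ S → g s ∈ A := fun hs => (hgS _ hs).1
  have hg : ∀ {s}, s ∈ S → f (g s) = s := fun hs => (hgS _ hs).2
  rw [← Set.ncard_prod]
  refine (Set.ncard_congr (fun p _ => g p.1 + p.2) ?_ ?_ ?_).symm
  · rintro ⟨s, k⟩ ⟨hs, hkA, hk⟩
    have hk : f k = 0 := hk
    refine ⟨A.add_mem (hgA hs) hkA, ?_⟩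
    simpa [hk, hg hs] using hs
  · rintro ⟨s, k⟩ ⟨s', k'⟩ ⟨hs, -, hk⟩ ⟨hs', -, hk'⟩ h
    have hk : f k = 0 := hk
    have hk' : f k' = 0 := hk'
    have h : g s + k = g s' + k' := h
    have hss : s = s' := by
      have := congrArg f h
      rwa [map_add, map_add, hk, hk', hg hs, hg hs', add_zero, add_zero] at this
    subst hss
    simpa using h
  · rintro x ⟨hxA, hx⟩
    refine ⟨(f x, x - g (f x)), ⟨hx, A.sub_mem hxA (hgA hx), ?_⟩, by simp⟩
    simp [hg hx]

theorem ncard_inter_preimage_mul (f : G →+ H) (A : AddSubgroup G) (B : AddSubgroup H)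
    (hAB : f '' A = B) {S : Set H} (hS : S ⊆ B) :
    ((A : Set G) ∩ f ⁻¹' S).ncard * (B : Set H).ncard = S.ncard * (A : Set G).ncard := by
  have hA : (A : Set G) ∩ f ⁻¹' B = A :=
    Set.inter_eq_left.2 fun x hx => hAB ▸ Set.mem_image_of_mem f hx
  have hB := ncard_inter_preimage_eq f A hAB.ge
  rw [hA] at hB
  rw [ncard_inter_preimage_eq f A (hS.trans hAB.ge), hB]
  ring

end FibreCounting

/-- `J = ⟨r⟩` is the maximal ideal of a local ring and the annihilator of `r`. -/
structure IsSquareZeroMaximal {K : Type*} [CommRing K] (J : Ideal K) (r : K) : Prop where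
  eq_span : J = Ideal.span {r}
  mem_iff_not_isUnit : ∀ x, x ∈ J ↔ ¬ IsUnit x
  mul_eq_zero_iff : ∀ x, r * x = 0 ↔ x ∈ J

theorem isSquareZeroMaximal_of_ideals {K : Type*} [CommRing K] {J : Ideal K} {r : K}
    (hJr : J = Ideal.span {r}) (hJbot : J ≠ ⊥) (hJtop : J ≠ ⊤)
    (hideals : ∀ I : Ideal K, I = ⊥ ∨ I = J ∨ I = ⊤) : IsSquareZeroMaximal J r := by
  have hunit : ∀ x, x ∈ J ↔ ¬ IsUnit x := by
    refine fun x => ⟨fun hx hu => hJtop (J.eq_top_of_isUnit_mem hx hu), fun hx => ?_⟩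
    rcases hideals (Ideal.span {x}) with h | h | h
    · rw [Ideal.span_singleton_eq_bot.1 h]
      exact J.zero_mem
    · exact h ▸ Ideal.mem_span_singleton_self x
    · exact absurd (Ideal.span_singleton_eq_top.1 h) hx
  have hr0 : r ≠ 0 := fun h => hJbot (by rw [hJr, h, Ideal.span_singleton_eq_bot])
  have hrJ : r ∈ J := hJr ▸ Ideal.mem_span_singleton_self r
  have hrr : r * r = 0 := by
    rcases hideals (Ideal.span {r * r}) with h | h | h
    · exact Ideal.span_singleton_eq_bot.1 h
    · obtain ⟨c, hc⟩ := Ideal.mem_span_singleton.1 (h ▸ hrJ)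
      have hu : IsUnit (1 - r * c) := by
        by_contra hn
        have h1 : (1 : K) ∈ J := by
          simpa using J.add_mem ((hunit _).2 hn) (J.mul_mem_right c hrJ)
        exact (hunit 1).1 h1 isUnit_one
      refine absurd ((hu.mul_left_eq_zero (a := r)).1 ?_) hr0
      linear_combination hc
    · exact absurd (Ideal.span_singleton_eq_top.1 h) ((hunit _).1 (J.mul_mem_right r hrJ))
  refine ⟨hJr, hunit, fun x => ⟨fun hx => ?_, fun hx => ?_⟩⟩
  · rw [hunit]
    exact fun hu => hr0 (hu.mul_left_eq_zero.1 hx)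
  · obtain ⟨c, rfl⟩ := Ideal.mem_span_singleton.1 (hJr ▸ hx)
    rw [← mul_assoc, hrr, zero_mul]

namespace IsSquareZeroMaximal

variable {K : Type*} [CommRing K] {J : Ideal K} {r : K}

theorem mul_eq_zero_of_mem (h : IsSquareZeroMaximal J r) {x y : K} (hx : x ∈ J) (hy : y ∈ J) :
    x * y = 0 := by
  obtain ⟨c, rfl⟩ := Ideal.mem_span_singleton.1 (h.eq_span ▸ hx)
  rw [mul_right_comm, (h.mul_eq_zero_iff y).2 hy, zero_mul]

theorem isUnit_one_add (h : IsSquareZeroMaximal J r) {x : K} (hx : x ∈ J) : IsUnit (1 + x) := by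
  by_contra hn
  have h1 : (1 : K) ∈ J := by simpa using J.sub_mem ((h.mem_iff_not_isUnit _).2 hn) hx
  exact (h.mem_iff_not_isUnit 1).1 h1 isUnit_one

theorem card_ideal (h : IsSquareZeroMaximal J r) : Nat.card J = Nat.card (K ⧸ J) := by
  have hker : LinearMap.ker (LinearMap.toSpanSingleton K K r) = J := by
    ext x
    rw [LinearMap.mem_ker, LinearMap.toSpanSingleton_apply, smul_eq_mul, mul_comm,
      h.mul_eq_zero_iff]
  have hrange : LinearMap.range (LinearMap.toSpanSingleton K K r) = J := by
    rw [LinearMap.range_toSpanSingleton]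
    exact h.eq_span.symm
  have := Nat.card_congr (LinearMap.quotKerEquivRange (LinearMap.toSpanSingleton K K r)).toEquiv
  rw [hrange, hker] at this
  exact this.symm

theorem card_ring [Finite K] (h : IsSquareZeroMaximal J r) :
    Nat.card K = Nat.card (K ⧸ J) * Nat.card (K ⧸ J) := by
  rw [Submodule.card_eq_card_quotient_mul_card J, h.card_ideal]

theorem card_units [Finite K] (h : IsSquareZeroMaximal J r) :
    Nat.card Kˣ + Nat.card J = Nat.card K := by
  rw [← Nat.card_sum]
  refine Nat.card_congr (Equiv.ofBijective (Sum.elim Units.val Subtype.val) ⟨?_, fun x => ?_⟩)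
  · refine Function.Injective.sumElim Units.val_injective Subtype.val_injective ?_
    rintro u ⟨x, hx⟩ rfl
    exact (h.mem_iff_not_isUnit _).1 hx u.isUnit
  · by_cases hx : IsUnit x
    · exact ⟨Sum.inl hx.unit, rfl⟩
    · exact ⟨Sum.inr ⟨x, (h.mem_iff_not_isUnit x).2 hx⟩, rfl⟩

end IsSquareZeroMaximal

theorem exists_dotProduct_eq_of_isUnit_minor {K ι : Type*} [CommRing K] [Fintype ι]
    [DecidableEq ι] {u v : ι → K} {i j : ι} (hij : IsUnit (u i * v j - u j * v i)) (c d : K) :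
    ∃ x : ι → K, x ⬝ᵥ u = c ∧ x ⬝ᵥ v = d := by
  obtain ⟨w, hw⟩ := hij.exists_left_inv
  refine ⟨Pi.single i (w * (c * v j - d * u j)) + Pi.single j (w * (u i * d - v i * c)), ?_, ?_⟩
  · rw [add_dotProduct, single_dotProduct, single_dotProduct]
    linear_combination c * hw
  · rw [add_dotProduct, single_dotProduct, single_dotProduct]
    linear_combination d * hw

section Tuples

variable {K : Type} [CommRing K] {e : ℕ}

/-- The linear map `x ↦ (x M aᵀ, x M bᵀ)`. -/
def sympFormPair (a b : Fin e ⊕ Fin e → K) : (Fin e ⊕ Fin e → K) →ₗ[K] K × K where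
  toFun x := (sympForm K e x a, sympForm K e x b)
  map_add' x y := by simp [sympForm, add_dotProduct]
  map_smul' c x := by simp [sympForm, smul_dotProduct]

theorem sympForm_units_smul (σ τ : Kˣ) (a b : Fin e ⊕ Fin e → K) :
    sympForm K e (σ • a) (τ • b) = (σ * τ : K) * sympForm K e a b := by
  simp only [sympForm, Units.smul_def, mulVec_smul, smul_dotProduct, dotProduct_smul, smul_eq_mul]
  ring

theorem sympFormPair_surjective_of_isUnit_minor {a b : Fin e ⊕ Fin e → K} {i j : Fin e ⊕ Fin e}
    (hij : IsUnit (a i * b j - a j * b i)) : Function.Surjective (sympFormPair a b) := by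
  rintro ⟨c, d⟩
  obtain ⟨y, hc, hd⟩ := exists_dotProduct_eq_of_isUnit_minor hij c d
  have key : ∀ v : Fin e ⊕ Fin e → K,
      sympForm K e (y ᵥ* (fromBlocks 0 (-1) 1 0 : Matrix _ _ K)) v = y ⬝ᵥ v := fun v => by
    rw [sympForm, dotProduct_mulVec, vecMul_vecMul, fromBlocks_multiply]
    simp
  exact ⟨_, Prod.ext ((key a).trans hc) ((key b).trans hd)⟩

/-- `T = J × ⋯ × J` as a submodule. -/
def idealTuples (J : Ideal K) (e : ℕ) : Submodule K (Fin e ⊕ Fin e → K) :=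
  Submodule.pi Set.univ fun _ => J

theorem mem_idealTuples {J : Ideal K} {x : Fin e ⊕ Fin e → K} :
    x ∈ idealTuples J e ↔ ∀ i, x i ∈ J := by
  simp [idealTuples]

theorem card_idealTuples [Finite K] (J : Ideal K) (e : ℕ) :
    Nat.card (idealTuples J e) = Nat.card J ^ (2 * e) := by
  have : idealTuples J e ≃ (Fin e ⊕ Fin e → J) :=
    ⟨fun x i => ⟨x.1 i, mem_idealTuples.1 x.2 i⟩, fun y => ⟨fun i => y i, mem_idealTuples.2
      fun i => (y i).2⟩, fun _ => rfl, fun _ => rfl⟩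
  rw [Nat.card_congr this, Nat.card_fun, Nat.card_sum, Nat.card_fin, two_mul]

theorem mem_unitTuples_iff {J : Ideal K} {r : K} (h : IsSquareZeroMaximal J r)
    {x : Fin e ⊕ Fin e → K} : x ∈ unitTuples K e ↔ x ∉ idealTuples J e := by
  simp only [mem_idealTuples, h.mem_iff_not_isUnit, not_forall, not_not]
  rfl

theorem cls_units_smul (σ : Kˣ) (x : Fin e ⊕ Fin e → K) : cls K e (σ • x) = cls K e x := by
  ext y
  constructor
  · rintro ⟨τ, rfl⟩
    exact ⟨τ * σ, smul_smul τ σ x⟩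
  · rintro ⟨τ, rfl⟩
    exact ⟨τ * σ⁻¹, by rw [smul_smul, inv_mul_cancel_right]⟩

theorem mem_cls_self (x : Fin e ⊕ Fin e → K) : x ∈ cls K e x :=
  ⟨1, (one_smul _ x).symm⟩

theorem units_smul_left_cancel {x : Fin e ⊕ Fin e → K} (hx : x ∈ unitTuples K e) {σ τ : Kˣ}
    (hστ : σ • x = τ • x) : σ = τ := by
  obtain ⟨i, hi⟩ := hx
  exact Units.ext (hi.mul_right_cancel (congrFun hστ i))

theorem units_smul_mem_unitTuples {x : Fin e ⊕ Fin e → K} (σ : Kˣ) (hx : x ∈ unitTuples K e) :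
    σ • x ∈ unitTuples K e := by
  obtain ⟨i, hi⟩ := hx
  exact ⟨i, σ.isUnit.mul hi⟩

theorem adjY_cls_iff {J : Ideal K} {x a : Fin e ⊕ Fin e → K} :
    adjY K J e (cls K e x) (cls K e a) ↔ sympForm K e x a ∈ J ∧ sympForm K e x a ≠ 0 := by
  constructor
  · rintro ⟨_, ⟨σ, rfl⟩, _, ⟨τ, rfl⟩, hJ, h0⟩
    rw [sympForm_units_smul] at hJ h0
    rw [← Units.val_mul] at hJ
    exact ⟨(J.unit_mul_mem_iff_mem (σ * τ).isUnit).1 hJ, right_ne_zero_of_mul h0⟩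
  · exact fun hx => ⟨x, mem_cls_self x, a, mem_cls_self a, hx⟩

/-- A family of classes is `|Kˣ|` times smaller than the set of tuples representing it. -/
theorem card_classes_sep_mul_card_units (P : Set (Fin e ⊕ Fin e → K) → Prop) :
    Nat.card ↥{C ∈ classes K e | P C} * Nat.card Kˣ =
      {x | x ∈ unitTuples K e ∧ P (cls K e x)}.ncard := by
  have hrep : ∀ C : ↥{C ∈ classes K e | P C}, ∃ x ∈ unitTuples K e, C.1 = cls K e x :=
    fun C => C.2.1
  choose g hg hgC using hrep
  rw [← Nat.card_prod, ← Nat.card_coe_set_eq]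
  refine Nat.card_congr (Equiv.ofBijective (fun p => ⟨p.2 • g p.1,
    units_smul_mem_unitTuples p.2 (hg p.1), ?_⟩) ⟨?_, ?_⟩)
  · rw [cls_units_smul, ← hgC]
    exact p.1.2.2
  · rintro ⟨C, σ⟩ ⟨D, τ⟩ hp
    have hp : σ • g C = τ • g D := congrArg Subtype.val hp
    have hCD : C = D := Subtype.ext <| by
      rw [hgC C, hgC D, ← cls_units_smul σ, hp, cls_units_smul]
    subst hCD
    rw [units_smul_left_cancel (hg C) hp]
  · rintro ⟨x, hx, hPx⟩
    let C : ↥{C ∈ classes K e | P C} := ⟨cls K e x, ⟨x, hx, rfl⟩, hPx⟩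
    obtain ⟨σ, hσ⟩ : x ∈ cls K e (g C) := hgC C ▸ mem_cls_self x
    exact ⟨(C, σ), Subtype.ext hσ.symm⟩

variable {J : Ideal K} {r : K}

theorem exists_isUnit_minor_or_eq_smul_add (h : IsSquareZeroMaximal J r)
    {a b : Fin e ⊕ Fin e → K} (ha : a ∈ unitTuples K e) (hb : b ∈ unitTuples K e) :
    (∃ i j, IsUnit (a i * b j - a j * b i)) ∨
      ∃ σ : Kˣ, ∃ t ∈ idealTuples J e, b = σ • (a + t) := by
  by_cases hm : ∃ i j, IsUnit (a i * b j - a j * b i)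
  · exact Or.inl hm
  right
  push Not at hm
  obtain ⟨i, hi⟩ := ha
  obtain ⟨k, hk⟩ := hb
  obtain ⟨w, hw⟩ := hi.exists_left_inv
  have hmem : ∀ j, a i * b j - a j * b i ∈ J := fun j => (h.mem_iff_not_isUnit _).2 (hm i j)
  have hbi : IsUnit (w * b i) := by
    by_contra hn
    have hn := (h.mem_iff_not_isUnit _).2 hn
    refine (h.mem_iff_not_isUnit (b k)).1 ?_ hk
    have := J.add_mem (J.mul_mem_left w (hmem k)) (J.mul_mem_left (a k) hn)
    convert this using 1
    linear_combination -b k * hw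
  obtain ⟨σ, hσ⟩ := hbi
  refine ⟨σ, σ⁻¹ • b - a, mem_idealTuples.2 fun j => ?_, by simp⟩
  have hj : (σ : K) * (((σ⁻¹ : Kˣ) : K) * b j - a j) = w * (a i * b j - a j * b i) := by
    rw [mul_sub, Units.mul_inv_cancel_left, hσ]
    linear_combination -b j * hw
  rw [← J.unit_mul_mem_iff_mem σ.isUnit]
  exact hj ▸ J.mul_mem_left w (hmem j)

theorem IsHyperplane.exists_eq_add_smul [Finite K] (h : IsSquareZeroMaximal J r)
    (he : 0 < e) {H : Submodule K (Fin e ⊕ Fin e → K)}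
    (hH : IsHyperplane K J e (Nat.card (K ⧸ J)) H) {u : Fin e ⊕ Fin e → K} (hu : r • u ∉ H)
    {t : Fin e ⊕ Fin e → K} (ht : t ∈ idealTuples J e) :
    ∃ x ∈ H, ∃ j ∈ J, t = x + j • u := by
  let f : H × J → idealTuples J e := fun p => ⟨p.1.1 + p.2.1 • u,
    add_mem (mem_idealTuples.2 (hH.1 p.1.2))
      (mem_idealTuples.2 fun _ => J.mul_mem_right _ p.2.2)⟩
  have hf : Function.Injective f := by
    rintro ⟨⟨x, hx⟩, ⟨j, hj⟩⟩ ⟨⟨y, hy⟩, ⟨k, hk⟩⟩ hxy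
    have hxy : x + j • u = y + k • u := congrArg Subtype.val hxy
    have hjk : (j - k) • u ∈ H := by
      have : (j - k) • u = y - x := by
        rw [sub_smul, sub_eq_sub_iff_add_eq_add, add_comm, hxy]
      exact this ▸ H.sub_mem hy hx
    obtain ⟨c, hc⟩ := Ideal.mem_span_singleton.1 (h.eq_span ▸ J.sub_mem hj hk)
    have hcJ : c ∈ J := by
      rw [h.mem_iff_not_isUnit]
      intro hcu
      obtain ⟨w, hw⟩ := hcu.exists_left_inv
      refine hu ?_
      have : r • u = w • (j - k) • u := by
        rw [smul_smul, hc]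
        congr 1
        linear_combination -r * hw
      exact this ▸ H.smul_mem w hjk
    rw [(h.mul_eq_zero_iff c).2 hcJ, sub_eq_zero] at hc
    subst hc
    simpa using hxy
  have hcard : Nat.card (H × J) = Nat.card (idealTuples J e) := by
    rw [Nat.card_prod, card_idealTuples, hH.2, h.card_ideal, ← pow_succ]
    congr 1
    omega
  obtain ⟨⟨x, j⟩, hp⟩ := ((Nat.bijective_iff_injective_and_card f).2 ⟨hf, hcard⟩).2 ⟨t, ht⟩
  exact ⟨x, x.2, j, j.2, (congrArg Subtype.val hp).symm⟩

/-- `C(H,u)` consists of all vertices congruent to `u` modulo `J`. -/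
theorem IsHyperplane.classSet_eq [Finite K] (h : IsSquareZeroMaximal J r)
    (he : 0 < e) {H : Submodule K (Fin e ⊕ Fin e → K)}
    (hH : IsHyperplane K J e (Nat.card (K ⧸ J)) H) {u : Fin e ⊕ Fin e → K} (hu : r • u ∉ H) :
    classSet K e H u = {S | ∃ t ∈ idealTuples J e, S = cls K e (u + t)} := by
  ext S
  constructor
  · rintro ⟨x, hx, rfl⟩
    exact ⟨x, mem_idealTuples.2 (hH.1 hx), rfl⟩
  · rintro ⟨t, ht, rfl⟩
    obtain ⟨x, hx, j, hj, rfl⟩ := exists_eq_add_smul h he hH hu ht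
    obtain ⟨σ, hσ⟩ := h.isUnit_one_add hj
    refine ⟨(σ⁻¹ : Kˣ) • x, H.smul_mem _ hx, ?_⟩
    rw [← cls_units_smul σ (u + (σ⁻¹ : Kˣ) • x), smul_add, smul_inv_smul, Units.smul_def, hσ,
      add_smul, one_smul, add_right_comm, add_assoc u]

theorem setOf_cls_add_eq (J : Ideal K) (σ : Kˣ) {u t₀ : Fin e ⊕ Fin e → K}
    (ht₀ : t₀ ∈ idealTuples J e) :
    {S | ∃ t ∈ idealTuples J e, S = cls K e (σ • (u + t₀) + t)} =
      {S | ∃ t ∈ idealTuples J e, S = cls K e (u + t)} := by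
  ext S
  constructor
  · rintro ⟨t, ht, rfl⟩
    refine ⟨t₀ + σ⁻¹ • t, add_mem ht₀ (Submodule.smul_mem _ ((σ⁻¹ : Kˣ) : K) ht), ?_⟩
    rw [← cls_units_smul σ (u + _), ← add_assoc, smul_add σ (u + t₀), smul_inv_smul]
  · rintro ⟨t, ht, rfl⟩
    refine ⟨σ • (t - t₀), Submodule.smul_mem _ (σ : K) (sub_mem ht ht₀), ?_⟩
    rw [← smul_add, cls_units_smul, add_add_sub_cancel]

/-- The number of tuples of `V'` whose products with `a` and with `b` both lie in `J ∖ {0}`. -/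
theorem ncard_common_neighbour_tuples [Finite K] (h : IsSquareZeroMaximal J r) (he : 0 < e)
    {a b : Fin e ⊕ Fin e → K} (hab : Function.Surjective (sympFormPair a b)) {q : ℕ}
    (hq : Nat.card (K ⧸ J) = q) :
    {x | x ∈ unitTuples K e ∧ (sympForm K e x a ∈ J ∧ sympForm K e x a ≠ 0) ∧
      (sympForm K e x b ∈ J ∧ sympForm K e x b ≠ 0)}.ncard =
      (q - 1) ^ 2 * (q ^ (2 * e - 2) * (q ^ (2 * e - 2) - 1)) := by
  let F : (Fin e ⊕ Fin e → K) →+ K × K := (sympFormPair a b).toAddMonoidHom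
  let P : Set K := (J : Set K) \ {0}
  let T := (idealTuples J e).toAddSubgroup
  obtain ⟨m, rfl⟩ : ∃ m, e = m + 1 := ⟨e - 1, by omega⟩
  have hm : 2 * (m + 1) - 2 = 2 * m := by omega
  have hqpos : 0 < q := hq ▸ h.card_ideal ▸ Nat.card_pos
  have hJ : (J : Set K).ncard = q := by
    rw [← hq, ← h.card_ideal]
    rfl
  have hP : P.ncard = q - 1 := by
    rw [Set.ncard_sdiff_singleton_of_mem J.zero_mem, hJ]
  have hPP : (P ×ˢ P).ncard = (q - 1) ^ 2 := by rw [Set.ncard_prod, hP, sq]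
  have hX : {x | x ∈ unitTuples K (m + 1) ∧
      (sympForm K (m + 1) x a ∈ J ∧ sympForm K (m + 1) x a ≠ 0) ∧
      (sympForm K (m + 1) x b ∈ J ∧ sympForm K (m + 1) x b ≠ 0)} =
      (F ⁻¹' (P ×ˢ P)) \ ((T : Set _) ∩ F ⁻¹' (P ×ˢ P)) := by
    ext x
    have : x ∈ unitTuples K (m + 1) ↔ x ∉ T := mem_unitTuples_iff h
    rw [Set.sdiff_inter_self_eq_sdiff]
    simp only [Set.mem_ofPred_eq, this]
    exact and_comm
  have hTimage : F '' T = (J.prod J).toAddSubgroup := by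
    ext ⟨c, d⟩
    constructor
    · rintro ⟨x, hx, hxc⟩
      have hx := mem_idealTuples.1 hx
      have hmem : ∀ v, sympForm K (m + 1) x v ∈ J := fun v => by
        rw [sympForm, dotProduct]
        exact J.sum_mem fun i _ => J.mul_mem_right _ (hx i)
      rw [← hxc]
      exact ⟨hmem a, hmem b⟩
    · rintro ⟨hc, hd⟩
      obtain ⟨c, rfl⟩ := Ideal.mem_span_singleton.1 (h.eq_span ▸ hc)
      obtain ⟨d, rfl⟩ := Ideal.mem_span_singleton.1 (h.eq_span ▸ hd)
      obtain ⟨x, hx⟩ := hab (c, d)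
      refine ⟨r • x, mem_idealTuples.2 fun i => J.mul_mem_right _ ?_,
        ((sympFormPair a b).map_smul r x).trans (by rw [hx]; rfl)⟩
      exact h.eq_span ▸ Ideal.mem_span_singleton_self r
  have hJJ : (((J.prod J).toAddSubgroup : AddSubgroup (K × K)) : Set (K × K)).ncard = q * q := by
    rw [← hJ, ← Set.ncard_prod]
    rfl
  have hT : (T : Set (Fin (m + 1) ⊕ Fin (m + 1) → K)).ncard = q ^ (2 * (m + 1)) := by
    rw [← hq, ← h.card_ideal, ← card_idealTuples]
    rfl
  have hfull : (F ⁻¹' (P ×ˢ P)).ncard = (q - 1) ^ 2 * (q ^ (2 * m) * q ^ (2 * m)) := by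
    have := ncard_inter_preimage_mul F ⊤ ⊤ (Set.image_univ.trans hab.range_eq) (S := P ×ˢ P)
      (Set.subset_univ _)
    rw [AddSubgroup.coe_top, AddSubgroup.coe_top, Set.univ_inter, Set.ncard_univ, Set.ncard_univ,
      Nat.card_prod, Nat.card_fun, Nat.card_sum, Nat.card_fin, h.card_ring, hq, hPP] at this
    refine Nat.eq_of_mul_eq_mul_right (show 0 < q * q * (q * q) by positivity) (this.trans ?_)
    ring
  have hideal : ((T : Set _) ∩ F ⁻¹' (P ×ˢ P)).ncard = (q - 1) ^ 2 * q ^ (2 * m) := by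
    have := ncard_inter_preimage_mul F T (J.prod J).toAddSubgroup hTimage (S := P ×ˢ P)
      fun p hp => ⟨hp.1.1, hp.2.1⟩
    rw [hJJ, hPP, hT] at this
    refine Nat.eq_of_mul_eq_mul_right (show 0 < q * q by positivity) (this.trans ?_)
    ring
  rw [hX, Set.ncard_sdiff Set.inter_subset_right, hfull, hideal, hm, ← Nat.mul_sub,
    Nat.mul_sub_one]

end Tuples

/-- Proposition: two vertices from different classes of the partition have
`q^(2e-3)·(q-1)·(q^(2e-2)-1)` common neighbours in `Y(2e,K)`. -/
theorem common_neighbours_Y_different_classes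
    (K : Type) [CommRing K] [Fintype K]
    (J : Ideal K) (r : K) (q : ℕ)
    (hJr : J = Ideal.span {r})
    (hJbot : J ≠ ⊥) (hJtop : J ≠ ⊤)
    (hideals : ∀ I : Ideal K, I = ⊥ ∨ I = J ∨ I = ⊤)
    (hq : IsPrimePow q)
    (hqcard : Nat.card (K ⧸ J) = q)
    (e : ℕ) (he : 2 ≤ e)
    (H₁ H₂ : Submodule K (Fin e ⊕ Fin e → K))
    (hH₁ : IsHyperplane K J e q H₁) (hH₂ : IsHyperplane K J e q H₂)
    (a b : Fin e ⊕ Fin e → K)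
    (ha : a ∈ unitTuples K e) (hb : b ∈ unitTuples K e)
    (hra : r • a ∉ H₁) (hrb : r • b ∉ H₂)
    (hCC : classSet K e H₁ a ≠ classSet K e H₂ b) :
    Nat.card ↥{C ∈ classes K e | adjY K J e C (cls K e a) ∧ adjY K J e C (cls K e b)} =
      q ^ (2 * e - 3) * (q - 1) * (q ^ (2 * e - 2) - 1) := by
  have h := isSquareZeroMaximal_of_ideals hJr hJbot hJtop hideals
  have he0 : 0 < e := by omega
  rw [← hqcard] at hH₁ hH₂
  have hsurj : Function.Surjective (sympFormPair a b) := by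
    rcases exists_isUnit_minor_or_eq_smul_add h ha hb with ⟨i, j, hij⟩ | ⟨σ, t, ht, rfl⟩
    · exact sympFormPair_surjective_of_isUnit_minor hij
    · refine absurd ?_ hCC
      rw [hH₁.classSet_eq h he0 hra, hH₂.classSet_eq h he0 hrb, setOf_cls_add_eq J σ ht]
  have hunits : Nat.card Kˣ = q * (q - 1) := by
    have := h.card_units
    rw [h.card_ring, h.card_ideal, hqcard] at this
    rw [Nat.mul_sub_one, ← this, Nat.add_sub_cancel]
  have hcount := card_classes_sep_mul_card_units (K := K) (e := e)
    fun C => adjY K J e C (cls K e a) ∧ adjY K J e C (cls K e b)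
  simp only [adjY_cls_iff] at hcount
  rw [ncard_common_neighbour_tuples h he0 hsurj hqcard, hunits] at hcount
  have hq1 : 0 < q - 1 := Nat.sub_pos_of_lt hq.one_lt
  have hpow : q ^ (2 * e - 2) = q ^ (2 * e - 3) * q := by
    rw [← pow_succ]
    congr 1
    omega
  refine Nat.eq_of_mul_eq_mul_right (Nat.mul_pos hq.pos hq1) (hcount.trans ?_)
  generalize q ^ (2 * e - 2) - 1 = m
  rw [hpow]
  ring
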